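/- There exist finite nonempty wire index sets I'_A, I_A, O_A, O'_A, I'_B, I_B, O_B, O'_B, each of cardinality 3, a boxworld process W over these wires, and sets of probabilistic local operations T^{A|X} on Alice's wires and T^{B|Y} on Bob's wires with classical sets A = B = X = Y = {0,1}, such that the generated correlations P̄ = (T^{A|X} ⊗ T^{B|Y}) * W satisfy GYNI(P̄) := (1/4)·Σ_{a,b,x,y} δ_{a,y}·δ_{b,x}·P̄(a, b | x, y) = 3/4. In particular, boxworld correlations violate the causal bound GYNI ≤ 1/2 of the 'guess your neighbor's input' inequality, reaching at least the value 3/4. -/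

import Mathlib

open Finset
open scoped Classical

noncomputable section

namespace Boxworld

/-- A bipartite 8-wire tensor `W(i'_A, o_A, i'_B, o_B | i_A, o'_A, i_B, o'_B)`,
with output indices `IA' OA IB' OB` and input indices `IA OA' IB OB'`. -/
abbrev WTen (IA' OA IB' OB IA OA' IB OB' : Type) : Type :=
  IA' → OA → IB' → OB → IA → OA' → IB → OB' → ℝ

/-- A local-operation tensor `T(i, o' | i', o)`, argument order `(i', o, i, o')`. -/
abbrev OpTen (I' O I O' : Type) : Type := I' → O → I → O' → ℝ

section WireDefs

variable {IA' OA IB' OB IA OA' IB OB' : Type}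
variable [Fintype IA'] [Fintype OA] [Fintype IB'] [Fintype OB]
variable [Fintype IA] [Fintype OA'] [Fintype IB] [Fintype OB']

/-- Reduce-and-replace over the index `IA'`. -/
def rrIA' (W : WTen IA' OA IB' OB IA OA' IB OB') : WTen IA' OA IB' OB IA OA' IB OB' :=
  fun _ oa ib' ob ia oa' ib ob' => (∑ j, W j oa ib' ob ia oa' ib ob') / (Fintype.card IA' : ℝ)

/-- Reduce-and-replace over the index `OA`. -/
def rrOA (W : WTen IA' OA IB' OB IA OA' IB OB') : WTen IA' OA IB' OB IA OA' IB OB' :=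
  fun ia' _ ib' ob ia oa' ib ob' => (∑ j, W ia' j ib' ob ia oa' ib ob') / (Fintype.card OA : ℝ)

/-- Reduce-and-replace over the index `IB'`. -/
def rrIB' (W : WTen IA' OA IB' OB IA OA' IB OB') : WTen IA' OA IB' OB IA OA' IB OB' :=
  fun ia' oa _ ob ia oa' ib ob' => (∑ j, W ia' oa j ob ia oa' ib ob') / (Fintype.card IB' : ℝ)

/-- Reduce-and-replace over the index `OB`. -/
def rrOB (W : WTen IA' OA IB' OB IA OA' IB OB') : WTen IA' OA IB' OB IA OA' IB OB' :=
  fun ia' oa ib' _ ia oa' ib ob' => (∑ j, W ia' oa ib' j ia oa' ib ob') / (Fintype.card OB : ℝ)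

/-- Reduce-and-replace over the index `IA`. -/
def rrIA (W : WTen IA' OA IB' OB IA OA' IB OB') : WTen IA' OA IB' OB IA OA' IB OB' :=
  fun ia' oa ib' ob _ oa' ib ob' => (∑ j, W ia' oa ib' ob j oa' ib ob') / (Fintype.card IA : ℝ)

/-- Reduce-and-replace over the index `OA'`. -/
def rrOA' (W : WTen IA' OA IB' OB IA OA' IB OB') : WTen IA' OA IB' OB IA OA' IB OB' :=
  fun ia' oa ib' ob ia _ ib ob' => (∑ j, W ia' oa ib' ob ia j ib ob') / (Fintype.card OA' : ℝ)

/-- Reduce-and-replace over the index `IB`. -/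
def rrIB (W : WTen IA' OA IB' OB IA OA' IB OB') : WTen IA' OA IB' OB IA OA' IB OB' :=
  fun ia' oa ib' ob ia oa' _ ob' => (∑ j, W ia' oa ib' ob ia oa' j ob') / (Fintype.card IB : ℝ)

/-- Reduce-and-replace over the index `OB'`. -/
def rrOB' (W : WTen IA' OA IB' OB IA OA' IB OB') : WTen IA' OA IB' OB IA OA' IB OB' :=
  fun ia' oa ib' ob ia oa' ib _ => (∑ j, W ia' oa ib' ob ia oa' ib j) / (Fintype.card OB' : ℝ)

/-- Total reduction `r(W)`: the sum of all entries of `W`. -/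
def tot (W : WTen IA' OA IB' OB IA OA' IB OB') : ℝ :=
  ∑ ia', ∑ oa, ∑ ib', ∑ ob, ∑ ia, ∑ oa', ∑ ib, ∑ ob', W ia' oa ib' ob ia oa' ib ob'

/-- Elementwise nonnegativity `W ≥ 0`. -/
def Nonneg8 (W : WTen IA' OA IB' OB IA OA' IB OB') : Prop :=
  ∀ ia' oa ib' ob ia oa' ib ob', 0 ≤ W ia' oa ib' ob ia oa' ib ob'

/-- Reduce-and-replace over all of Alice's indices `𝔸 = I'_A I_A O_A O'_A`. -/
def rrA (W : WTen IA' OA IB' OB IA OA' IB OB') : WTen IA' OA IB' OB IA OA' IB OB' :=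
  rrIA' (rrIA (rrOA (rrOA' W)))

/-- Reduce-and-replace over all of Bob's indices `𝔹 = I'_B I_B O_B O'_B`. -/
def rrB (W : WTen IA' OA IB' OB IA OA' IB OB') : WTen IA' OA IB' OB IA OA' IB OB' :=
  rrIB' (rrIB (rrOB (rrOB' W)))

/-- The combination `_{(1 − O'_A + O_A O'_A − I_A O_A O'_A)}W`. -/
def LA (W : WTen IA' OA IB' OB IA OA' IB OB') : WTen IA' OA IB' OB IA OA' IB OB' :=
  W - rrOA' W + rrOA (rrOA' W) - rrIA (rrOA (rrOA' W))

/-- The combination `_{(1 − O'_B + O_B O'_B − I_B O_B O'_B)}W`. -/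
def LB (W : WTen IA' OA IB' OB IA OA' IB OB') : WTen IA' OA IB' OB IA OA' IB OB' :=
  W - rrOB' W + rrOB (rrOB' W) - rrIB (rrOB (rrOB' W))

/-- A bipartite process tensor. -/
def IsProcessTensor (W : WTen IA' OA IB' OB IA OA' IB OB') : Prop :=
  Nonneg8 W ∧
  tot W = (Fintype.card IA : ℝ) * (Fintype.card OA' : ℝ) *
      (Fintype.card IB : ℝ) * (Fintype.card OB' : ℝ) ∧
  rrA (LB W) = 0 ∧
  rrB (LA W) = 0 ∧
  LA (LB W) = 0

/-- Reduce-and-replace over all primed indices `O'_A O'_B I'_A I'_B`. -/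
def rrPrimes (W : WTen IA' OA IB' OB IA OA' IB OB') : WTen IA' OA IB' OB IA OA' IB OB' :=
  rrOA' (rrOB' (rrIA' (rrIB' W)))

/-- The combination `_{(1 − O'_A + O'_A I'_A − O'_B O'_A I'_A)}W`. -/
def MA (W : WTen IA' OA IB' OB IA OA' IB OB') : WTen IA' OA IB' OB IA OA' IB OB' :=
  W - rrOA' W + rrIA' (rrOA' W) - rrOB' (rrIA' (rrOA' W))

/-- The combination `_{(1 − O'_B + O'_B I'_B − O'_A O'_B I'_B)}W`. -/
def MB (W : WTen IA' OA IB' OB IA OA' IB OB') : WTen IA' OA IB' OB IA OA' IB OB' :=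
  W - rrOB' W + rrIB' (rrOB' W) - rrOA' (rrIB' (rrOB' W))

/-- The four nonsignaling-preservation (NSP) conditions. -/
def SatisfiesNSP (W : WTen IA' OA IB' OB IA OA' IB OB') : Prop :=
  rrOA (rrPrimes W) = rrIA (rrOA (rrPrimes W)) ∧
  rrOB (rrPrimes W) = rrIB (rrOB (rrPrimes W)) ∧
  rrOA (MA W) = rrIA (rrOA (MA W)) ∧
  rrOB (MB W) = rrIB (rrOB (MB W))

/-- A boxworld process. -/
def IsBoxworldProcess (W : WTen IA' OA IB' OB IA OA' IB OB') : Prop :=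
  Nonneg8 W ∧
  tot W = (Fintype.card IA : ℝ) * (Fintype.card OA' : ℝ) *
      (Fintype.card IB : ℝ) * (Fintype.card OB' : ℝ) ∧
  rrA W = rrOB' (rrA W) ∧
  rrB W = rrOA' (rrB W) ∧
  W = rrOA' W + rrOB' W - rrOA' (rrOB' W) ∧
  rrOA W = rrIA (rrOA W) ∧
  rrOB W = rrIB (rrOB W)

/-- The action `W * P` of a process tensor on a bipartite box
`P(o'_A, o'_B | i'_A, i'_B)`, contracting the indices `O'_A, O'_B, I'_A, I'_B`. -/
def actOnBox (W : WTen IA' OA IB' OB IA OA' IB OB')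
    (P : OA' → OB' → IA' → IB' → ℝ) : OA → OB → IA → IB → ℝ :=
  fun oa ob ia ib =>
    ∑ ia', ∑ ib', ∑ oa', ∑ ob', W ia' oa ib' ob ia oa' ib ob' * P oa' ob' ia' ib'

end WireDefs

section OpDefs

variable {I' O I O' : Type}
variable [Fintype I'] [Fintype O] [Fintype I] [Fintype O']

/-- Reduce-and-replace over the index `I'` of an operation tensor. -/
def rrOpI' (T : OpTen I' O I O') : OpTen I' O I O' :=
  fun _ o i o' => (∑ j, T j o i o') / (Fintype.card I' : ℝ)

/-- Reduce-and-replace over the index `O` of an operation tensor. -/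
def rrOpO (T : OpTen I' O I O') : OpTen I' O I O' :=
  fun i' _ i o' => (∑ j, T i' j i o') / (Fintype.card O : ℝ)

/-- Reduce-and-replace over the index `I` of an operation tensor. -/
def rrOpI (T : OpTen I' O I O') : OpTen I' O I O' :=
  fun i' o _ o' => (∑ j, T i' o j o') / (Fintype.card I : ℝ)

/-- Reduce-and-replace over the index `O'` of an operation tensor. -/
def rrOpO' (T : OpTen I' O I O') : OpTen I' O I O' :=
  fun i' o i _ => (∑ j, T i' o i j) / (Fintype.card O' : ℝ)

/-- Total reduction of an operation tensor. -/
def totOp (T : OpTen I' O I O') : ℝ := ∑ i', ∑ o, ∑ i, ∑ o', T i' o i o'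

/-- A deterministic local operation. -/
def IsDetOp (T : OpTen I' O I O') : Prop :=
  totOp T = (Fintype.card I' : ℝ) * (Fintype.card O : ℝ) ∧
  rrOpI (rrOpO' T) = rrOpI' (rrOpI (rrOpO (rrOpO' T))) ∧
  rrOpO' T = rrOpO (rrOpO' T)

/-- A set of probabilistic local operations `T^{a|x}(i, o' | i', o)`:
nonnegative tensors whose sum over the classical outcome `a` is, for each
classical input `x`, a deterministic local operation. -/
def IsLocalOps {A X : Type} [Fintype A] (T : A → X → OpTen I' O I O') : Prop :=
  (∀ a x i' o i o', 0 ≤ T a x i' o i o') ∧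
  ∀ x, IsDetOp (fun i' o i o' => ∑ a, T a x i' o i o')

/-- A nonsignaling set of probabilistic local operations: either the
deterministic operation `T^x` is independent of `x` (case 1), or it is a
convex combination of deterministic pre-processings `f_λ` (possibly depending
on `x`) and post-processings `g_λ` independent of both the box output and `x`
(case 2). -/
def IsNSLocalOps {A X : Type} [Fintype A] (T : A → X → OpTen I' O I O') : Prop :=
  IsLocalOps T ∧
  ((∀ x x' i' o i o', (∑ a, T a x i' o i o') = ∑ a, T a x' i' o i o') ∨
    ∃ (m : ℕ) (π : Fin m → ℝ) (f : Fin m → I' → X → I) (g : Fin m → I' → O'),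
      (∀ l, 0 ≤ π l) ∧ (∑ l, π l = 1) ∧
      ∀ x i' o i o', (∑ a, T a x i' o i o') =
        ∑ l, π l * ((if i = f l i' x then (1 : ℝ) else 0) *
          (if o' = g l i' then (1 : ℝ) else 0)))

end OpDefs

/-- A bipartite nonsignaling box `P(o_1, o_2 | i_1, i_2)`. -/
def IsNSBox {O1 O2 I1 I2 : Type} [Fintype O1] [Fintype O2]
    (P : O1 → O2 → I1 → I2 → ℝ) : Prop :=
  (∀ o1 o2 i1 i2, 0 ≤ P o1 o2 i1 i2) ∧
  (∀ i1 i2, ∑ o1, ∑ o2, P o1 o2 i1 i2 = 1) ∧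
  (∀ o1 i1 i2 i2', ∑ o2, P o1 o2 i1 i2 = ∑ o2, P o1 o2 i1 i2') ∧
  (∀ o2 i1 i1' i2, ∑ o1, P o1 o2 i1 i2 = ∑ o1, P o1 o2 i1' i2)

section Corr

variable {IA' OA IB' OB IA OA' IB OB' : Type}
variable [Fintype IA'] [Fintype OA] [Fintype IB'] [Fintype OB]
variable [Fintype IA] [Fintype OA'] [Fintype IB] [Fintype OB']
variable {A X B Y : Type}

/-- The correlations `(T^{A|X} ⊗ T^{B|Y}) * W` generated by local operations
acting on a process tensor: contraction over all eight wire indices. -/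
def corr (TA : A → X → OpTen IA' OA IA OA') (TB : B → Y → OpTen IB' OB IB OB')
    (W : WTen IA' OA IB' OB IA OA' IB OB') (a : A) (b : B) (x : X) (y : Y) : ℝ :=
  ∑ ia', ∑ oa, ∑ ib', ∑ ob, ∑ ia, ∑ oa', ∑ ib, ∑ ob',
    TA a x ia' oa ia oa' * TB b y ib' ob ib ob' * W ia' oa ib' ob ia oa' ib ob'

end Corr

/-- The part of the weights of the process in which Alice's last output `p` is signalled to Bob,
for box outputs `oa`, `ob` and box inputs `ia`, `ib`. -/
def halfWeight (oa ob ia ib p : Fin 3) : ℕ :=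
  if ia = 0 then
    if ib = 0 then (if oa = 1 ∧ ob = 0 then 1 else 0)
    else (if oa ≠ 2 ∧ ob = (if p = oa + 1 then 1 else 0) then 1 else 0)
  else
    if ib = 0 then 0
    else (if oa = 0 ∧ ob = (if p = 0 then 0 else 1) then 1 else 0)

/-- The symmetric sum of the two one-way signalling weights. -/
def weight (oa ob ia pa ib pb : Fin 3) : ℕ :=
  halfWeight oa ob ia ib pa + halfWeight ob oa ib ia pb

theorem weight_swap (oa ob ia pa ib pb : Fin 3) :
    weight oa ob ia pa ib pb = weight ob oa ib pb ia pa :=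
  Nat.add_comm _ _

/-- Bob's marginal weights do not depend on Alice's box input nor on Bob's last output. -/
theorem sum_weight_left (ob ia pa ib pb : Fin 3) :
    ∑ oa, weight oa ob ia pa ib pb = ∑ oa, weight oa ob 0 pa ib 0 := by
  simp only [Fin.sum_univ_three]
  revert ob ia pa ib pb
  decide

theorem sum_weight_right (oa ia pa ib pb : Fin 3) :
    ∑ ob, weight oa ob ia pa ib pb = ∑ ob, weight oa ob ia 0 0 pb := by
  simp only [weight_swap oa]
  exact sum_weight_left oa ib pb ia pa

/-- The process attaining the value, uniform in the first inputs received by the two parties. -/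
def proc : WTen (Fin 3) (Fin 3) (Fin 3) (Fin 3) (Fin 3) (Fin 3) (Fin 3) (Fin 3) :=
  fun _ oa _ ob ia pa ib pb => (weight oa ob ia pa ib pb : ℝ) / 18

theorem rrOA_proc : rrOA proc =
    fun _ _ _ ob _ pa ib _ => ((∑ oa, weight oa ob 0 pa ib 0 : ℕ) : ℝ) / 54 := by
  funext _ _ _ ob ia pa ib pb
  simp only [rrOA, proc, ← Finset.sum_div, ← Nat.cast_sum, sum_weight_left ob ia pa ib pb,
    Fintype.card_fin]
  push_cast
  ring

theorem rrOB_proc : rrOB proc =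
    fun _ oa _ _ ia _ _ pb => ((∑ ob, weight oa ob ia 0 0 pb : ℕ) : ℝ) / 54 := by
  funext _ oa _ _ ia pa ib pb
  simp only [rrOB, proc, ← Finset.sum_div, ← Nat.cast_sum, sum_weight_right oa ia pa ib pb,
    Fintype.card_fin]
  push_cast
  ring

theorem rrOA_rrOA' {IA' OA IB' OB IA OA' IB OB' : Type} [Fintype OA] [Fintype OA']
    (W : WTen IA' OA IB' OB IA OA' IB OB') : rrOA (rrOA' W) = rrOA' (rrOA W) := by
  funext
  simp only [rrOA, rrOA', ← Finset.sum_div]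
  rw [Finset.sum_comm, div_right_comm]

theorem rrOB_rrOB' {IA' OA IB' OB IA OA' IB OB' : Type} [Fintype OB] [Fintype OB']
    (W : WTen IA' OA IB' OB IA OA' IB OB') : rrOB (rrOB' W) = rrOB' (rrOB W) := by
  funext
  simp only [rrOB, rrOB', ← Finset.sum_div]
  rw [Finset.sum_comm, div_right_comm]

theorem sum_weight :
    ∑ oa, ∑ ob, ∑ ia, ∑ pa, ∑ ib, ∑ pb, weight oa ob ia pa ib pb = 162 := by
  decide

theorem tot_proc : tot proc = 81 := by
  have h : ∑ oa, ∑ ob, ∑ ia, ∑ pa, ∑ ib, ∑ pb, (weight oa ob ia pa ib pb : ℝ) = 162 := by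
    exact_mod_cast sum_weight
  simp only [tot, proc, ← Finset.sum_div, Finset.sum_const, Finset.card_univ, Fintype.card_fin,
    ← Finset.smul_sum, h]
  norm_num

theorem isBoxworldProcess_proc : IsBoxworldProcess proc := by
  refine ⟨?_, ?_, ?_, ?_, ?_, ?_, ?_⟩
  · intro _ oa _ ob ia pa ib pb
    unfold proc
    positivity
  · rw [tot_proc]
    norm_num
  · rw [rrA, rrOA_rrOA', rrOA_proc]
    funext
    simp [rrIA', rrIA, rrOA', rrOB']
  · rw [rrB, rrOB_rrOB', rrOB_proc]
    funext
    simp [rrIB', rrIB, rrOB', rrOA']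
  · funext _ oa _ ob ia pa ib pb
    simp only [proc, weight, rrOA', rrOB', Pi.add_apply, Pi.sub_apply, Fin.sum_univ_three,
      Fintype.card_fin]
    push_cast
    ring
  · rw [rrOA_proc]
    funext
    simp [rrIA]
  · rw [rrOB_proc]
    funext
    simp [rrIB]

/-- The classical outcome given the classical input `x` and the box output `o`. -/
def outcome (x : Fin 2) (o : Fin 3) : Fin 2 := if x = 0 ∨ o = 0 then 1 else 0

/-- The last output given the classical input `x` and the box output `o`. -/
def lastOut (x : Fin 2) (o : Fin 3) : Fin 3 := if x = 0 then o + 1 else 0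

/-- The deterministic local operations used by both parties: the box input is `x`. -/
def localOp (a x : Fin 2) : OpTen (Fin 3) (Fin 3) (Fin 3) (Fin 3) :=
  fun _ o i p =>
    if i = x.castSucc then if p = lastOut x o then if a = outcome x o then 1 else 0 else 0 else 0

theorem isLocalOps_localOp : IsLocalOps localOp := by
  refine ⟨fun a x _ o i p => ?_, fun x => ?_⟩
  · unfold localOp
    positivity
  · have h : (fun i' o i p => ∑ a, localOp a x i' o i p) =
        fun _ o i p => if i = x.castSucc then if p = lastOut x o then (1 : ℝ) else 0 else 0 := by
      funext _ o i p
      simp only [localOp]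
      split_ifs <;> simp
    rw [h]
    refine ⟨?_, ?_, ?_⟩
    · simp [totOp]
    · funext
      simp [rrOpI, rrOpO, rrOpO', rrOpI', Finset.sum_ite_irrel]
    · funext
      simp [rrOpO, rrOpO', Finset.sum_ite_irrel]

theorem corr_localOp_proc (a b x y : Fin 2) : corr localOp localOp proc a b x y =
    ((∑ oa, ∑ ob, if a = outcome x oa ∧ b = outcome y ob then
      weight oa ob x.castSucc (lastOut x oa) y.castSucc (lastOut y ob) else 0 : ℕ) : ℝ) / 2 := by
  have h (oa ob : Fin 3) :
      ∑ ia, ∑ pa, ∑ ib, ∑ pb, localOp a x 0 oa ia pa * localOp b y 0 ob ib pb *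
        proc 0 oa 0 ob ia pa ib pb =
      ((if a = outcome x oa ∧ b = outcome y ob then
        weight oa ob x.castSucc (lastOut x oa) y.castSucc (lastOut y ob) else 0 : ℕ) : ℝ) / 18 := by
    by_cases ha : a = outcome x oa <;> by_cases hb : b = outcome y ob <;>
      simp [localOp, proc, ha, hb]
  calc corr localOp localOp proc a b x y
      = ∑ _ia' : Fin 3, ∑ oa, ∑ _ib' : Fin 3, ∑ ob, _ :=
        Finset.sum_congr rfl fun _ _ => Finset.sum_congr rfl fun oa _ =>
          Finset.sum_congr rfl fun _ _ => Finset.sum_congr rfl fun ob _ => h oa ob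
    _ = _ := by
      simp only [← Finset.sum_div, Finset.sum_const, Finset.card_univ, Fintype.card_fin,
        nsmul_eq_mul, ← Finset.mul_sum]
      push_cast
      ring

theorem statement_17 :
    ∃ (W : WTen (Fin 3) (Fin 3) (Fin 3) (Fin 3) (Fin 3) (Fin 3) (Fin 3) (Fin 3))
      (TA TB : Fin 2 → Fin 2 → OpTen (Fin 3) (Fin 3) (Fin 3) (Fin 3)),
      IsBoxworldProcess W ∧ IsLocalOps TA ∧ IsLocalOps TB ∧
      (1 / 4 : ℝ) * ∑ a, ∑ b, ∑ x, ∑ y,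
          (if a = y then (1 : ℝ) else 0) * (if b = x then (1 : ℝ) else 0) *
            corr TA TB W a b x y = 3 / 4 := by
  refine ⟨proc, localOp, localOp, isBoxworldProcess_proc, isLocalOps_localOp,
    isLocalOps_localOp, ?_⟩
  have h : ∑ a, ∑ b, ∑ x, ∑ y, (if a = y then 1 else 0) * (if b = x then 1 else 0) *
      (∑ oa, ∑ ob, if a = outcome x oa ∧ b = outcome y ob then
        weight oa ob x.castSucc (lastOut x oa) y.castSucc (lastOut y ob) else 0) = 6 := by
    decide
  have h' := congrArg (Nat.cast (R := ℝ)) h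
  push_cast at h'
  simp only [corr_localOp_proc, ← mul_div_assoc, ← Finset.sum_div]
  push_cast
  rw [h']
  norm_num

end Boxworld

end
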